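/- arXiv:quant-ph/0110125 — 3 statements merged into one kernel-verified Lean document; each statement's English description precedes it below -/
import Mathlib

section
/- (Relative entropy bound for the pinched state.) For every n ≥ 1, D(ρ‖σ) ≤ (1/n) D(E_{σ_n}(ρ_n) ‖ σ_n) + (d/n) log(n+1). -/
open Matrix Filter
open scoped ComplexOrder

noncomputable section

/-- Functional calculus for a Hermitian matrix: apply `f` to the eigenvalues. -/
def matFun {m : Type*} [Fintype m] [DecidableEq m] (f : ℝ → ℝ) (A : Matrix m m ℂ) :
    Matrix m m ℂ :=
  if hA : A.IsHermitian then
    (hA.eigenvectorUnitary : Matrix m m ℂ) *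
      Matrix.diagonal (fun i => (f (hA.eigenvalues i) : ℂ)) *
      star (hA.eigenvectorUnitary : Matrix m m ℂ)
  else 0

/-- Matrix logarithm (via functional calculus). -/
def matLog {m : Type*} [Fintype m] [DecidableEq m] (A : Matrix m m ℂ) : Matrix m m ℂ :=
  matFun Real.log A

/-- Real matrix power (via functional calculus). -/
def matRPow {m : Type*} [Fintype m] [DecidableEq m] (A : Matrix m m ℂ) (s : ℝ) :
    Matrix m m ℂ :=
  matFun (fun x => x ^ s) A

open Classical in
/-- The finite set of (distinct, real) eigenvalues of a Hermitian matrix. -/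
def eigFinset {m : Type*} [Fintype m] [DecidableEq m] (A : Matrix m m ℂ) : Finset ℝ :=
  if hA : A.IsHermitian then Finset.image hA.eigenvalues Finset.univ else ∅

/-- `v A`: the number of distinct eigenvalues of a Hermitian matrix `A`. -/
def numEig {m : Type*} [Fintype m] [DecidableEq m] (A : Matrix m m ℂ) : ℕ :=
  (eigFinset A).card

/-- The spectral projection of a Hermitian matrix `A` corresponding to eigenvalue `μ`. -/
def specProj {m : Type*} [Fintype m] [DecidableEq m] (A : Matrix m m ℂ) (μ : ℝ) :
    Matrix m m ℂ :=
  matFun (fun x => if x = μ then 1 else 0) A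

/-- The pinching `E_A(B) = Σ_i E_i B E_i` of `B` by the Hermitian matrix `A`. -/
def pinch {m : Type*} [Fintype m] [DecidableEq m] (A B : Matrix m m ℂ) : Matrix m m ℂ :=
  ∑ μ ∈ eigFinset A, specProj A μ * B * specProj A μ

/-- `{X > 0}`: the projection onto the strictly positive eigenspaces of a Hermitian `X`. -/
def posProj {m : Type*} [Fintype m] [DecidableEq m] (X : Matrix m m ℂ) : Matrix m m ℂ :=
  matFun (fun x => if 0 < x then 1 else 0) X

/-- The `n`-fold tensor (Kronecker) power of a `d × d` matrix, realized on the index type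
`Fin n → Fin d`. -/
def tensorPow {d : ℕ} (ρ : Matrix (Fin d) (Fin d) ℂ) (n : ℕ) :
    Matrix (Fin n → Fin d) (Fin n → Fin d) ℂ :=
  fun x y => ∏ i, ρ (x i) (y i)

/-- A density matrix: positive semidefinite with unit trace. -/
def IsDensity {m : Type*} [Fintype m] [DecidableEq m] (ρ : Matrix m m ℂ) : Prop :=
  ρ.PosSemidef ∧ ρ.trace = 1

/-- A test: an operator `A` with `0 ≤ A ≤ I` in the Loewner order. -/
def IsTest {m : Type*} [Fintype m] [DecidableEq m] (A : Matrix m m ℂ) : Prop :=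
  A.PosSemidef ∧ (1 - A).PosSemidef

/-- The quantum relative entropy `D(ρ‖σ) = Tr[ρ (log ρ − log σ)]`. -/
def relEnt {m : Type*} [Fintype m] [DecidableEq m] (ρ σ : Matrix m m ℂ) : ℝ :=
  ((ρ * (matLog ρ - matLog σ)).trace).re

/-- The error probability of the first kind, `α_n(A) = Tr[ρ_n (I − A)]`. -/
def alphaErr {d : ℕ} (ρ : Matrix (Fin d) (Fin d) ℂ) (n : ℕ)
    (A : Matrix (Fin n → Fin d) (Fin n → Fin d) ℂ) : ℝ :=
  ((tensorPow ρ n * (1 - A)).trace).re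

/-- The error probability of the second kind, `β_n(A) = Tr[σ_n A]`. -/
def betaErr {d : ℕ} (σ : Matrix (Fin d) (Fin d) ℂ) (n : ℕ)
    (A : Matrix (Fin n → Fin d) (Fin n → Fin d) ℂ) : ℝ :=
  ((tensorPow σ n * A).trace).re

/-- `β*_n(ε)`: the minimum type-II error among tests with type-I error at most `ε`. -/
def betaStar {d : ℕ} (ρ σ : Matrix (Fin d) (Fin d) ℂ) (n : ℕ) (ε : ℝ) : ℝ :=
  sInf {b : ℝ | ∃ A : Matrix (Fin n → Fin d) (Fin n → Fin d) ℂ,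
    IsTest A ∧ alphaErr ρ n A ≤ ε ∧ b = betaErr σ n A}

section helpers

variable {m : Type*} [Fintype m] [DecidableEq m]

lemma matFun_of_herm {A : Matrix m m ℂ} (hA : A.IsHermitian) (f : ℝ → ℝ) :
    matFun f A = (hA.eigenvectorUnitary : Matrix m m ℂ) *
      Matrix.diagonal (fun i => (f (hA.eigenvalues i) : ℂ)) *
      star (hA.eigenvectorUnitary : Matrix m m ℂ) := by
  rw [matFun, dif_pos hA]

lemma conj_diag_mul {U : Matrix m m ℂ} (hU : star U * U = 1) (a b : m → ℂ) :
    (U * diagonal a * star U) * (U * diagonal b * star U)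
      = U * diagonal (fun i => a i * b i) * star U := by
  calc _ = U * diagonal a * (star U * U) * diagonal b * star U := by
        simp only [Matrix.mul_assoc]
    _ = _ := by rw [hU, Matrix.mul_one, Matrix.mul_assoc U, diagonal_mul_diagonal]

lemma conj_diag_aeval {U : Matrix m m ℂ} (hU : star U * U = 1) (a : m → ℝ)
    (p : Polynomial ℝ) :
    Polynomial.aeval (U * diagonal (fun i => (a i : ℂ)) * star U) p
      = U * diagonal (fun i => ((p.eval (a i) : ℝ) : ℂ)) * star U := by
  have hU' : U * star U = 1 := mul_eq_one_comm.mp hU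
  induction p using Polynomial.induction_on' with
  | add p q hp hq =>
    rw [map_add, hp, hq, ← Matrix.add_mul, ← Matrix.mul_add, diagonal_add]
    simp
  | monomial k c =>
    have hpow : ∀ k : ℕ, (U * diagonal (fun i => (a i : ℂ)) * star U) ^ k
        = U * diagonal (fun i => ((a i : ℂ)) ^ k) * star U := by
      intro k
      induction k with
      | zero => simp [hU']
      | succ k ih => rw [pow_succ, ih, conj_diag_mul hU]; simp only [pow_succ]
    rw [Polynomial.aeval_monomial, hpow, ← Algebra.smul_def, ← Matrix.smul_mul,
      ← Matrix.mul_smul]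
    congr 2
    ext i j
    by_cases h : i = j
    · subst h; simp
    · simp [h]

lemma exists_interp (S : Finset ℝ) (f : ℝ → ℝ) :
    ∃ p : Polynomial ℝ, ∀ x ∈ S, p.eval x = f x := by
  classical
  refine ⟨Lagrange.interpolate S id f, fun x hx => ?_⟩
  have := Lagrange.eval_interpolate_at_node (s := S) (v := id) f (Function.injective_id.injOn) hx
  simpa using this

lemma herm_spec {A : Matrix m m ℂ} (hA : A.IsHermitian) :
    A = (hA.eigenvectorUnitary : Matrix m m ℂ) *
      Matrix.diagonal (fun i => (hA.eigenvalues i : ℂ)) *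
      star (hA.eigenvectorUnitary : Matrix m m ℂ) := by
  have := hA.spectral_theorem
  rw [Unitary.conjStarAlgAut_apply] at this
  exact this

lemma eigU {A : Matrix m m ℂ} (hA : A.IsHermitian) :
    star (hA.eigenvectorUnitary : Matrix m m ℂ) * (hA.eigenvectorUnitary : Matrix m m ℂ) = 1 :=
  Unitary.coe_star_mul_self _

lemma matFun_poly {A : Matrix m m ℂ} (hA : A.IsHermitian) (f : ℝ → ℝ) (p : Polynomial ℝ)
    (hp : ∀ i, p.eval (hA.eigenvalues i) = f (hA.eigenvalues i)) :
    matFun f A = Polynomial.aeval A p := by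
  rw [matFun_of_herm hA]
  conv_rhs => rw [herm_spec hA]
  rw [conj_diag_aeval (eigU hA)]
  simp only [hp]

lemma conj_diag_herm (U : Matrix m m ℂ) (a : m → ℝ) :
    (U * diagonal (fun i => (a i : ℂ)) * star U).IsHermitian := by
  have h : (diagonal (fun i => (a i : ℂ))).IsHermitian := by
    ext i j
    by_cases h : i = j
    · subst h; simp
    · simp [h, Ne.symm h]
  exact isHermitian_mul_mul_conjTranspose U h

lemma matFun_conj {U : Matrix m m ℂ} (hU : star U * U = 1) (a : m → ℝ) (f : ℝ → ℝ) :
    matFun f (U * diagonal (fun i => (a i : ℂ)) * star U)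
      = U * diagonal (fun i => (f (a i) : ℂ)) * star U := by
  classical
  have hA := conj_diag_herm U a
  obtain ⟨p, hp⟩ := exists_interp
    (Finset.image hA.eigenvalues Finset.univ ∪ Finset.image a Finset.univ) f
  rw [matFun_poly hA f p (fun i => hp _ (by simp)), conj_diag_aeval hU]
  have : ∀ i, p.eval (a i) = f (a i) := fun i => hp _ (by simp)
  simp only [this]

lemma eig_mem {U : Matrix m m ℂ} (hU : star U * U = 1) (a : m → ℝ)
    {x : ℝ} (hx : x ∈ eigFinset (U * diagonal (fun i => (a i : ℂ)) * star U)) :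
    ∃ i, a i = x := by
  classical
  by_contra hcon
  push Not at hcon
  have hA := conj_diag_herm U a
  rw [eigFinset, dif_pos hA] at hx
  simp only [Finset.mem_image, Finset.mem_univ, true_and] at hx
  obtain ⟨k, hk⟩ := hx
  have h1 := matFun_conj hU a (fun y => if y = x then 1 else 0)
  rw [matFun_of_herm hA] at h1
  simp only [hcon, if_false] at h1
  have h0 : U * diagonal (fun _ : m => ((0 : ℝ) : ℂ)) * star U = 0 := by
    simp
  rw [h0] at h1
  have h2 : star (hA.eigenvectorUnitary : Matrix m m ℂ) * ((hA.eigenvectorUnitary : Matrix m m ℂ) *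
      Matrix.diagonal (fun i => (((if hA.eigenvalues i = x then 1 else 0 : ℝ)) : ℂ)) *
      star (hA.eigenvectorUnitary : Matrix m m ℂ)) * (hA.eigenvectorUnitary : Matrix m m ℂ)
      = 0 := by
    rw [h1]; simp
  rw [← Matrix.mul_assoc, ← Matrix.mul_assoc, eigU, Matrix.mul_assoc, eigU] at h2
  have h3 := congrFun (congrFun h2 k) k
  simp [hk] at h3

lemma specProj_herm {A : Matrix m m ℂ} (hA : A.IsHermitian) (x : ℝ) :
    (specProj A x).IsHermitian := by
  rw [specProj, matFun_of_herm hA]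
  exact conj_diag_herm _ (fun i => if hA.eigenvalues i = x then (1 : ℝ) else 0)

lemma specProj_mul {A : Matrix m m ℂ} (hA : A.IsHermitian) (x y : ℝ) :
    specProj A x * specProj A y = if x = y then specProj A x else 0 := by
  rw [specProj, specProj, matFun_of_herm hA, matFun_of_herm hA, conj_diag_mul (eigU hA)]
  split_ifs with h
  · subst h
    congr 3
    ext i
    split_ifs <;> simp
  · have : ∀ i, (((if hA.eigenvalues i = x then 1 else 0 : ℝ)) : ℂ) *
        (((if hA.eigenvalues i = y then 1 else 0 : ℝ)) : ℂ) = 0 := by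
      intro i
      split_ifs with h1 h2
      · exact absurd (h1.symm.trans h2) h
      all_goals simp
    simp only [this]
    simp

lemma specProj_sum {A : Matrix m m ℂ} (hA : A.IsHermitian) :
    ∑ x ∈ eigFinset A, specProj A x = 1 := by
  classical
  simp only [specProj, matFun_of_herm hA]
  rw [← Finset.sum_mul, ← Finset.mul_sum]
  have : ∑ x ∈ eigFinset A, diagonal (fun i =>
      (((if hA.eigenvalues i = x then 1 else 0 : ℝ)) : ℂ)) = 1 := by
    ext i j
    rw [Matrix.sum_apply]
    by_cases h : i = j
    · subst h
      have hm : hA.eigenvalues i ∈ eigFinset A := by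
        rw [eigFinset, dif_pos hA]; simp
      simp only [diagonal_apply_eq, one_apply_eq]
      rw [← Complex.ofReal_sum, Finset.sum_ite_eq]
      simp [hm]
    · simp [h]
  rw [this, Matrix.mul_one]
  exact Unitary.coe_mul_star_self _

lemma specProj_comm {A : Matrix m m ℂ} (hA : A.IsHermitian) (f : ℝ → ℝ) (x : ℝ) :
    Commute (matFun f A) (specProj A x) := by
  unfold Commute SemiconjBy
  rw [specProj, matFun_of_herm hA, matFun_of_herm hA, conj_diag_mul (eigU hA),
    conj_diag_mul (eigU hA)]
  simp only [mul_comm]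

lemma matFun_commute {A B : Matrix m m ℂ} (hA : A.IsHermitian) (h : Commute A B) (f : ℝ → ℝ) :
    Commute (matFun f A) B := by
  classical
  obtain ⟨p, hp⟩ := exists_interp (Finset.image hA.eigenvalues Finset.univ) f
  rw [matFun_poly hA f p (fun i => hp _ (by simp))]
  clear hp
  induction p using Polynomial.induction_on' with
  | add p q hp hq => rw [map_add]; exact hp.add_left hq
  | monomial k c =>
    rw [Polynomial.aeval_monomial]
    exact (Algebra.commute_algebraMap_left c B).mul_left (h.pow_left k)

lemma trace_pinch_mul {A B L : Matrix m m ℂ} (hA : A.IsHermitian)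
    (hL : ∀ x, Commute L (specProj A x)) :
    (pinch A B * L).trace = (B * L).trace := by
  rw [pinch, Finset.sum_mul, trace_sum]
  have : ∀ x ∈ eigFinset A, (specProj A x * B * specProj A x * L).trace
      = (B * L * specProj A x).trace := by
    intro x _
    have h1 : specProj A x * B * specProj A x * L = specProj A x * (B * (specProj A x * L)) := by
      simp only [Matrix.mul_assoc]
    rw [h1, trace_mul_comm, ← (hL x).eq]
    have h2 : B * (L * specProj A x) * specProj A x
        = B * L * (specProj A x * specProj A x) := by simp only [Matrix.mul_assoc]
    rw [h2, specProj_mul hA, if_pos rfl]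
  rw [Finset.sum_congr rfl this, ← trace_sum, ← Finset.mul_sum, specProj_sum hA, Matrix.mul_one]

lemma pinch_comm {A B : Matrix m m ℂ} (hA : A.IsHermitian) (x : ℝ) :
    Commute (pinch A B) (specProj A x) := by
  unfold Commute SemiconjBy
  rw [pinch, Finset.sum_mul, Finset.mul_sum]
  refine Finset.sum_congr rfl fun y _ => ?_
  have h1 : specProj A x * (specProj A y * B * specProj A y)
      = (specProj A x * specProj A y) * B * specProj A y := by simp only [Matrix.mul_assoc]
  rw [Matrix.mul_assoc, specProj_mul hA, h1, specProj_mul hA]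
  by_cases h : x = y
  · subst h; simp
  · simp [h, Ne.symm h]

lemma pinch_ineq {A B : Matrix m m ℂ} (hA : A.IsHermitian) (hB : B.PosSemidef) :
    ((numEig A : ℂ) • pinch A B - B).PosSemidef := by
  have key : (numEig A : ℂ) • pinch A B - B = (1 / 2 : ℂ) • ∑ x ∈ eigFinset A,
      ∑ y ∈ eigFinset A, (specProj A x - specProj A y) * B * (specProj A x - specProj A y) := by
    have e : ∀ x y, (specProj A x - specProj A y) * B * (specProj A x - specProj A y)
       = specProj A x * B * specProj A x + specProj A y * B * specProj A y
        - specProj A x * B * specProj A y - specProj A y * B * specProj A x := by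
      intro x y; noncomm_ring
    have hBs : ∑ x ∈ eigFinset A, ∑ y ∈ eigFinset A, specProj A x * B * specProj A y = B := by
      simp only [← Finset.mul_sum, specProj_sum hA, Matrix.mul_one]
      rw [← Finset.sum_mul, specProj_sum hA, Matrix.one_mul]
    have hBs' : ∑ x ∈ eigFinset A, ∑ y ∈ eigFinset A, specProj A y * B * specProj A x = B := by
      rw [Finset.sum_comm, hBs]
    simp only [e, Finset.sum_sub_distrib, Finset.sum_add_distrib, hBs, hBs', Finset.sum_const]
    rw [← Finset.smul_sum]
    rw [← pinch, numEig, ← Nat.cast_smul_eq_nsmul ℂ]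
    module
  rw [key]
  refine PosSemidef.smul (posSemidef_sum _ fun x _ => posSemidef_sum _ fun y _ => ?_) ?_
  · have := hB.mul_mul_conjTranspose_same (specProj A x - specProj A y)
    rwa [((specProj_herm hA x).sub (specProj_herm hA y)).eq] at this
  · have : (0 : ℝ) ≤ 1 / 2 := by norm_num
    have h2 : ((1 / 2 : ℝ) : ℂ) = 1 / 2 := by norm_num
    rw [← h2]
    exact_mod_cast this

open scoped MatrixOrder Matrix.Norms.L2Operator in
lemma matLog_eq {A : Matrix m m ℂ} (hA : A.IsHermitian) : matLog A = CFC.log A := by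
  rw [CFC.log, hA.cfc_eq, matLog, matFun_of_herm hA, IsHermitian.cfc,
    Unitary.conjStarAlgAut_apply]
  rfl

open scoped MatrixOrder Matrix.Norms.L2Operator in
lemma log_bound {B P : Matrix m m ℂ} (hB : B.PosDef) (hP : P.PosDef) (htr : B.trace = 1)
    (v : ℝ) (hv : 0 < v) (h : ((v : ℂ) • P - B).PosSemidef) :
    (B * matLog B).trace.re - (B * matLog P).trace.re ≤ Real.log v := by
  have h1 : B ≤ v • P := by
    rw [Matrix.le_iff]
    exact h
  have h2 := CFC.log_le_log h1 (Matrix.isStrictlyPositive_iff_posDef.mpr hB)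
  rw [CFC.log_smul' P hv (Matrix.isStrictlyPositive_iff_posDef.mpr hP), ← matLog_eq hB.1,
    ← matLog_eq hP.1, Matrix.le_iff] at h2
  obtain ⟨C, hC⟩ := CStarAlgebra.nonneg_iff_eq_star_mul_self.mp (nonneg_iff_posSemidef.mpr hB.posSemidef)
  rw [star_eq_conjTranspose] at hC
  have h3 := (h2.mul_mul_conjTranspose_same C).trace_nonneg
  rw [trace_mul_comm, ← Matrix.mul_assoc, ← hC, Matrix.mul_sub, Matrix.mul_add, trace_sub,
    trace_add, Algebra.algebraMap_eq_smul_one, Matrix.mul_smul, Matrix.mul_one, trace_smul,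
    htr] at h3
  have h4 := (Complex.le_def.mp h3).1
  simp at h4
  linarith

lemma posDef_of_smul_sub {B P : Matrix m m ℂ} (hB : B.PosDef) (v : ℝ) (hv : 0 < v)
    (h : ((v : ℂ) • P - B).PosSemidef) : P.PosDef := by
  have h1 : ((v : ℂ) • P).PosDef := by
    have := hB.add_posSemidef h
    rwa [add_sub_cancel] at this
  have hv' : (0 : ℂ) < ((v⁻¹ : ℝ) : ℂ) := by exact_mod_cast inv_pos.mpr hv
  have h2 := h1.smul hv'
  rw [smul_smul, ← Complex.ofReal_mul, inv_mul_cancel₀ hv.ne'] at h2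
  simpa using h2

lemma numEig_pos {A B : Matrix m m ℂ} (hA : A.IsHermitian) (htr : B.trace = 1) :
    0 < numEig A := by
  rw [numEig, Finset.card_pos, Finset.nonempty_iff_ne_empty]
  intro h
  have h1 := specProj_sum hA
  rw [h, Finset.sum_empty] at h1
  rw [← Matrix.one_mul B, ← h1] at htr
  simp at htr

lemma relEnt_le_pinch {A B : Matrix m m ℂ} (hA : A.PosDef) (hB : B.PosDef) (htr : B.trace = 1) :
    relEnt B A ≤ relEnt (pinch A B) A + Real.log (numEig A) := by
  have hv : (0 : ℝ) < numEig A := by exact_mod_cast numEig_pos hA.1 htr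
  have hin := pinch_ineq hA.1 hB.posSemidef
  rw [← Complex.ofReal_natCast] at hin
  have hP := posDef_of_smul_sub hB _ hv hin
  have hlog := log_bound hB hP htr _ hv hin
  have e1 : (pinch A B * matLog A).trace = (B * matLog A).trace :=
    trace_pinch_mul hA.1 fun x => specProj_comm hA.1 _ x
  have e2 : (pinch A B * matLog (pinch A B)).trace = (B * matLog (pinch A B)).trace :=
    trace_pinch_mul hA.1 fun x => matFun_commute hP.1 (pinch_comm hA.1 x) _
  simp only [relEnt, Matrix.mul_sub, trace_sub, Complex.sub_re]
  rw [e1, e2]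
  linarith

end helpers

section tensor

variable {d : ℕ}

lemma tensorPow_mul (A B : Matrix (Fin d) (Fin d) ℂ) (n : ℕ) :
    tensorPow (A * B) n = tensorPow A n * tensorPow B n := by
  ext x y
  simp only [tensorPow, Matrix.mul_apply, ← Finset.prod_mul_distrib]
  rw [Finset.prod_univ_sum]
  simp

lemma tensorPow_diag (a : Fin d → ℂ) (n : ℕ) :
    tensorPow (diagonal a) n = diagonal (fun x => ∏ i, a (x i)) := by
  ext x y
  by_cases h : x = y
  · subst h; simp [tensorPow]
  · rw [diagonal_apply_ne _ h]
    obtain ⟨i, hi⟩ := Function.ne_iff.mp h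
    exact Finset.prod_eq_zero (Finset.mem_univ i) (diagonal_apply_ne _ hi)

lemma tensorPow_one (n : ℕ) : tensorPow (1 : Matrix (Fin d) (Fin d) ℂ) n = 1 := by
  rw [← diagonal_one, tensorPow_diag]; simp

lemma tensorPow_star (A : Matrix (Fin d) (Fin d) ℂ) (n : ℕ) :
    tensorPow (star A) n = star (tensorPow A n) := by
  ext x y
  simp [tensorPow, star_apply]

lemma tensorPow_trace (A : Matrix (Fin d) (Fin d) ℂ) (n : ℕ) :
    (tensorPow A n).trace = A.trace ^ n := by
  simp only [Matrix.trace, tensorPow, diag_apply]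
  have h := Finset.prod_univ_sum (fun _ : Fin n => (Finset.univ : Finset (Fin d)))
    (fun _ j => A j j)
  rw [Fintype.piFinset_univ] at h
  rw [← h]
  simp

lemma tensorPow_spec {A : Matrix (Fin d) (Fin d) ℂ} (hA : A.IsHermitian) (n : ℕ) :
    tensorPow A n = tensorPow (hA.eigenvectorUnitary : Matrix (Fin d) (Fin d) ℂ) n *
      diagonal (fun x => ((∏ i, hA.eigenvalues (x i) : ℝ) : ℂ)) *
      star (tensorPow (hA.eigenvectorUnitary : Matrix (Fin d) (Fin d) ℂ) n) := by
  conv_lhs => rw [herm_spec hA]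
  rw [tensorPow_mul, tensorPow_mul, tensorPow_diag, tensorPow_star]
  simp

lemma tensorPow_unit {A : Matrix (Fin d) (Fin d) ℂ} (hA : A.IsHermitian) (n : ℕ) :
    star (tensorPow (hA.eigenvectorUnitary : Matrix (Fin d) (Fin d) ℂ) n) *
      tensorPow (hA.eigenvectorUnitary : Matrix (Fin d) (Fin d) ℂ) n = 1 := by
  rw [← tensorPow_star, ← tensorPow_mul, eigU, tensorPow_one]

lemma tensorPow_posDef {A : Matrix (Fin d) (Fin d) ℂ} (hA : A.PosDef) (n : ℕ) :
    (tensorPow A n).PosDef := by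
  rw [tensorPow_spec hA.1]
  have hu := tensorPow_unit hA.1 n
  have hD : (diagonal (fun x : Fin n → Fin d =>
      ((∏ i, hA.1.eigenvalues (x i) : ℝ) : ℂ))).PosDef := by
    refine PosDef.diagonal fun x => ?_
    have : 0 < ∏ i, hA.1.eigenvalues (x i) :=
      Finset.prod_pos fun i _ => hA.eigenvalues_pos _
    exact_mod_cast this
  refine hD.mul_mul_conjTranspose_same ?_
  exact vecMul_injective_of_isUnit (IsUnit.of_mul_eq_one _ (mul_eq_one_comm.mp hu))

lemma numEig_le {A : Matrix (Fin d) (Fin d) ℂ} (hA : A.IsHermitian) (n : ℕ) :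
    numEig (tensorPow A n) ≤ (n + 1) ^ d := by
  classical
  rw [numEig]
  have hsub : eigFinset (tensorPow A n) ⊆ Finset.image
      (fun c : Fin d → Fin (n + 1) => ∏ j, hA.eigenvalues j ^ (c j : ℕ)) Finset.univ := by
    intro t ht
    rw [tensorPow_spec hA] at ht
    obtain ⟨x, rfl⟩ := eig_mem (tensorPow_unit hA n) _ ht
    simp only [Finset.mem_image, Finset.mem_univ, true_and]
    refine ⟨fun j => ⟨(Finset.univ.filter fun i => x i = j).card, ?_⟩, ?_⟩
    · exact Nat.lt_succ_of_le ((Finset.card_le_univ _).trans (by simp))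
    · rw [← Finset.prod_fiberwise Finset.univ x]
      refine Finset.prod_congr rfl fun j _ => ?_
      rw [← Finset.prod_const]
      refine Finset.prod_congr rfl fun i hi => ?_
      rw [(Finset.mem_filter.mp hi).2]
  refine (Finset.card_le_card hsub).trans (Finset.card_image_le.trans ?_)
  simp

lemma trace_log_tensor {A B : Matrix (Fin d) (Fin d) ℂ} (hA : A.PosDef) (htr : B.trace = 1)
    (n : ℕ) :
    (tensorPow B n * matLog (tensorPow A n)).trace = n * (B * matLog A).trace := by
  set U : Matrix (Fin d) (Fin d) ℂ := (hA.1.eigenvectorUnitary : Matrix (Fin d) (Fin d) ℂ) with hUdef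
  set a := hA.1.eigenvalues with ha
  set C := star U * B * U with hC
  have hCtr : ∑ j, C j j = 1 := by
    have : C.trace = 1 := by
      rw [hC, trace_mul_comm, ← Matrix.mul_assoc, hUdef,
        mul_eq_one_comm.mp (eigU hA.1), Matrix.one_mul, htr]
    exact this
  have gen : ∀ {k : Type} [Fintype k] [DecidableEq k] (V X : Matrix k k ℂ) (b : k → ℂ),
      (X * (V * diagonal b * star V)).trace = ∑ i, (star V * X * V) i i * b i := by
    intro k _ _ V X b
    rw [← Matrix.mul_assoc, trace_mul_comm, ← Matrix.mul_assoc, ← Matrix.mul_assoc]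
    simp [Matrix.trace, mul_diagonal]
  have e1 : (B * matLog A).trace = ∑ j, C j j * (Real.log (a j) : ℂ) := by
    rw [matLog, matFun_of_herm hA.1, gen]
  have e2 : (tensorPow B n * matLog (tensorPow A n)).trace
      = ∑ x : Fin n → Fin d, (∏ i, C (x i) (x i)) * ∑ k, (Real.log (a (x k)) : ℂ) := by
    rw [matLog, tensorPow_spec hA.1, matFun_conj (tensorPow_unit hA.1 n), gen]
    refine Finset.sum_congr rfl fun x _ => ?_
    rw [← tensorPow_star, ← tensorPow_mul, ← tensorPow_mul, ← hUdef, ← hC]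
    rw [Real.log_prod (fun i _ => (hA.eigenvalues_pos _).ne')]
    simp [tensorPow, ha]
  rw [e1, e2]
  simp only [Finset.mul_sum]
  rw [Finset.sum_comm]
  have : ∀ k : Fin n, ∑ x : Fin n → Fin d, (∏ i, C (x i) (x i)) * (Real.log (a (x k)) : ℂ)
      = ∑ j, C j j * (Real.log (a j) : ℂ) := by
    intro k
    have h1 : ∀ x : Fin n → Fin d, (∏ i, C (x i) (x i)) * (Real.log (a (x k)) : ℂ)
        = ∏ i, (C (x i) (x i) * (if i = k then (Real.log (a (x i)) : ℂ) else 1)) := by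
      intro x
      rw [Finset.prod_mul_distrib, Finset.prod_ite_eq']
      simp
    simp only [h1]
    have h2 := Finset.prod_univ_sum (fun _ : Fin n => (Finset.univ : Finset (Fin d)))
      (fun i j => C j j * (if i = k then (Real.log (a j) : ℂ) else 1))
    rw [Fintype.piFinset_univ] at h2
    rw [← h2, Finset.prod_eq_single k]
    · simp
    · intro i _ hik
      simp [hik, hCtr]
    · simp
  rw [Finset.sum_congr rfl fun k _ => this k]
  simp [Finset.mul_sum]

end tensor

/-- **Relative entropy bound for the pinched state.**
`D(ρ‖σ) ≤ (1/n) D(E_{σ_n}(ρ_n)‖σ_n) + (d/n) log(n+1)`. -/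
theorem pinched_relEnt_lower_bound {d : ℕ} (hd : 0 < d) (ρ σ : Matrix (Fin d) (Fin d) ℂ)
    (hρ : IsDensity ρ) (hσ : IsDensity σ) (hρpd : ρ.PosDef) (hσpd : σ.PosDef)
    (n : ℕ) (hn : 1 ≤ n) :
    relEnt ρ σ ≤ (1 / (n : ℝ)) *
        relEnt (pinch (tensorPow σ n) (tensorPow ρ n)) (tensorPow σ n)
      + ((d : ℝ) / (n : ℝ)) * Real.log ((n : ℝ) + 1) := by
  have hn' : (0 : ℝ) < n := by exact_mod_cast hn
  have htr : (tensorPow ρ n).trace = 1 := by rw [tensorPow_trace, hρ.2, one_pow]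
  have h1 := relEnt_le_pinch (tensorPow_posDef hσpd n) (tensorPow_posDef hρpd n) htr
  have h2 : relEnt (tensorPow ρ n) (tensorPow σ n) = n * relEnt ρ σ := by
    simp only [relEnt, Matrix.mul_sub, trace_sub, Complex.sub_re]
    rw [trace_log_tensor hρpd hρ.2, trace_log_tensor hσpd hρ.2]
    simp [mul_sub]
  have hv : (0 : ℝ) < numEig (tensorPow σ n) := by
    exact_mod_cast numEig_pos (tensorPow_posDef hσpd n).1 htr
  have h3 : Real.log (numEig (tensorPow σ n)) ≤ d * Real.log ((n : ℝ) + 1) := by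
    rw [← Real.log_pow]
    exact Real.log_le_log hv (by exact_mod_cast numEig_le hσpd.1 n)
  rw [h2] at h1
  have h4 : relEnt ρ σ ≤ (relEnt (pinch (tensorPow σ n) (tensorPow ρ n)) (tensorPow σ n)
      + d * Real.log ((n : ℝ) + 1)) / n := by
    rw [le_div_iff₀ hn']
    linarith
  refine h4.trans (le_of_eq ?_)
  ring

end
end

section
/- (Relative entropy lower bound from a test.) For every n ≥ 1 and every test A_n with 0 < β_n(A_n) < 1 and 0 ≤ α_n(A_n) ≤ 1, D(ρ‖σ) ≥ −(log 2)/n − (1 − α_n(A_n)) · (1/n) log β_n(A_n). -/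
open Matrix Filter
open scoped ComplexOrder

noncomputable section

lemma aux_trace1 {m : Type*} [Fintype m] [DecidableEq m] (U V X : Matrix m m ℂ)
    (hU : U * Uᴴ = 1) (hV : V * Vᴴ = 1) (p : m → ℝ) (hX : Xᴴ = X) :
    ((U * diagonal (fun i => (p i : ℂ)) * Uᴴ * X).trace).re =
      ∑ i, ∑ j, p i * ((Uᴴ * X * V) i j * star ((Uᴴ * V) i j)).re := by
  have h : (U * diagonal (fun i => (p i : ℂ)) * Uᴴ * X).trace =
      (diagonal (fun i => (p i : ℂ)) * ((Uᴴ * X * V) * (Uᴴ * V)ᴴ)).trace := by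
    rw [conjTranspose_mul, conjTranspose_conjTranspose]
    have : Uᴴ * X * V * (Vᴴ * U) = Uᴴ * X * U := by
      rw [Matrix.mul_assoc (Uᴴ * X), ← Matrix.mul_assoc V, hV, Matrix.one_mul]
    rw [this, Matrix.mul_assoc, Matrix.mul_assoc, Matrix.trace_mul_comm]
    simp only [Matrix.mul_assoc]
  rw [h]
  simp only [trace, diag, diagonal_mul, Complex.re_sum, Complex.re_ofReal_mul]
  refine Finset.sum_congr rfl fun i _ => ?_
  rw [Matrix.mul_apply, Complex.re_sum, Finset.mul_sum]
  rfl

lemma aux_trace2 {m : Type*} [Fintype m] [DecidableEq m] (U V X : Matrix m m ℂ)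
    (hV : V * Vᴴ = 1) (p : m → ℝ) (hX : Xᴴ = X) :
    ((U * diagonal (fun i => (p i : ℂ)) * Uᴴ * (X * X)).trace).re =
      ∑ i, ∑ j, p i * Complex.normSq ((Uᴴ * X * V) i j) := by
  have h : (U * diagonal (fun i => (p i : ℂ)) * Uᴴ * (X * X)).trace =
      (diagonal (fun i => (p i : ℂ)) * ((Uᴴ * X * V) * (Uᴴ * X * V)ᴴ)).trace := by
    rw [conjTranspose_mul, conjTranspose_mul, conjTranspose_conjTranspose, hX]
    have : Uᴴ * X * V * (Vᴴ * (X * U)) = Uᴴ * (X * X) * U := by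
      rw [Matrix.mul_assoc (Uᴴ * X), ← Matrix.mul_assoc V, hV, Matrix.one_mul]
      simp only [Matrix.mul_assoc]
    rw [this, Matrix.mul_assoc, Matrix.mul_assoc, Matrix.trace_mul_comm]
    simp only [Matrix.mul_assoc]
  rw [h]
  simp only [trace, diag, diagonal_mul, Complex.re_sum, Complex.re_ofReal_mul]
  refine Finset.sum_congr rfl fun i _ => ?_
  rw [Matrix.mul_apply, Complex.re_sum, Finset.mul_sum]
  refine Finset.sum_congr rfl fun j _ => ?_
  rw [conjTranspose_apply, ← starRingEnd_apply, Complex.mul_conj, Complex.ofReal_re]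

lemma aux_normSq_symm {m : Type*} [Fintype m] [DecidableEq m] (U V X : Matrix m m ℂ)
    (hX : Xᴴ = X) (i j : m) :
    Complex.normSq ((Vᴴ * X * U) j i) = Complex.normSq ((Uᴴ * X * V) i j) := by
  have : (Vᴴ * X * U) = (Uᴴ * X * V)ᴴ := by
    simp [conjTranspose_mul, hX, Matrix.mul_assoc]
  rw [this, conjTranspose_apply, ← starRingEnd_apply, Complex.normSq_conj]

lemma aux_point (w z : ℂ) (p c : ℝ) (hc : 0 < c) :
    2 * (p * (z * star w).re) - c * Complex.normSq z ≤ Complex.normSq w * (p ^ 2 / c) := by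
  have h : 0 ≤ ((p * w.re - c * z.re) ^ 2 + (p * w.im - c * z.im) ^ 2) / c := by positivity
  have h2 : ((p * w.re - c * z.re) ^ 2 + (p * w.im - c * z.im) ^ 2) / c =
      Complex.normSq w * (p ^ 2 / c) - (2 * (p * (z * star w).re) - c * Complex.normSq z) := by
    rw [Complex.normSq_apply, Complex.normSq_apply]
    simp only [Complex.mul_re, Complex.star_def, Complex.conj_re, Complex.conj_im]
    field_simp
    ring
  linarith

lemma aux_var {m : Type*} [Fintype m] [DecidableEq m] (U V X : Matrix m m ℂ)
    (hU : U * Uᴴ = 1) (hV : V * Vᴴ = 1) (p q : m → ℝ) (hX : Xᴴ = X)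
    (hp : ∀ i, 0 < p i) (hq : ∀ i, 0 < q i) (s : ℝ) (hs : 0 ≤ s) :
    2 * ((U * diagonal (fun i => (p i : ℂ)) * Uᴴ * X).trace).re
      - ((V * diagonal (fun i => (q i : ℂ)) * Vᴴ * (X * X)).trace).re
      - s * ((U * diagonal (fun i => (p i : ℂ)) * Uᴴ * (X * X)).trace).re ≤
    ∑ i, ∑ j, Complex.normSq ((Uᴴ * V) i j) * ((p i) ^ 2 / (q j + s * p i)) := by
  rw [aux_trace1 U V X hU hV p hX, aux_trace2 U V X hV p hX, aux_trace2 V U X hU q hX,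
    Finset.sum_comm (f := fun i j => q i * _)]
  simp only [aux_normSq_symm U V X hX, Finset.mul_sum]
  simp only [← Finset.sum_sub_distrib]
  refine Finset.sum_le_sum fun i _ => Finset.sum_le_sum fun j _ => ?_
  have hc : 0 < q j + s * p i := add_pos_of_pos_of_nonneg (hq j) (mul_nonneg hs (hp i).le)
  have := aux_point ((Uᴴ * V) i j) ((Uᴴ * X * V) i j) (p i) _ hc
  refine le_trans (le_of_eq ?_) this
  ring

lemma aux_trace_nonneg {m : Type*} [Fintype m] [DecidableEq m] (U M : Matrix m m ℂ)
    (p : m → ℝ) (hp : ∀ i, 0 < p i) (hM : M.PosSemidef) :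
    0 ≤ ((U * diagonal (fun i => (p i : ℂ)) * Uᴴ * M).trace).re := by
  have h : (U * diagonal (fun i => (p i : ℂ)) * Uᴴ * M).trace =
      (diagonal (fun i => (p i : ℂ)) * (Uᴴ * M * U)).trace := by
    rw [Matrix.mul_assoc, Matrix.mul_assoc, Matrix.trace_mul_comm]
    simp only [Matrix.mul_assoc]
  rw [h]
  simp only [trace, diag, diagonal_mul, Complex.re_sum, Complex.re_ofReal_mul]
  refine Finset.sum_nonneg fun i _ => mul_nonneg (hp i).le ?_
  have := (hM.conjTranspose_mul_mul_same U).diag_nonneg (i := i)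
  exact (Complex.le_def.1 this).1

lemma aux_test_sq {m : Type*} [Fintype m] [DecidableEq m] (A : Matrix m m ℂ) (hA : IsTest A) :
    (A - A * A).PosSemidef := by
  have h1 := hA.2.conjTranspose_mul_mul_same A
  have h2 := hA.1.conjTranspose_mul_mul_same (1 - A)
  rw [hA.1.1.eq] at h1
  rw [hA.2.1.eq] at h2
  have := h1.add h2
  convert this using 1
  noncomm_ring

lemma aux_sq_bound {m : Type*} [Fintype m] [DecidableEq m] (U A : Matrix m m ℂ)
    (p : m → ℝ) (hp : ∀ i, 0 < p i) (hA : IsTest A) (c e : ℝ) :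
    ((U * diagonal (fun i => (p i : ℂ)) * Uᴴ *
      (((c : ℂ) • A + (e : ℂ) • (1 - A)) * ((c : ℂ) • A + (e : ℂ) • (1 - A)))).trace).re ≤
    c ^ 2 * ((U * diagonal (fun i => (p i : ℂ)) * Uᴴ * A).trace).re
      + e ^ 2 * ((U * diagonal (fun i => (p i : ℂ)) * Uᴴ * (1 - A)).trace).re := by
  have h0 := aux_trace_nonneg U _ p hp (aux_test_sq A hA)
  set R := U * diagonal (fun i => (p i : ℂ)) * Uᴴ
  have h1 : ((c : ℂ) • A + (e : ℂ) • (1 - A)) * ((c : ℂ) • A + (e : ℂ) • (1 - A)) =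
    ((c ^ 2 : ℝ) : ℂ) • A + ((e ^ 2 : ℝ) : ℂ) • (1 - A)
      - (((c - e) ^ 2 : ℝ) : ℂ) • (A - A * A) := by
    push_cast
    simp only [mul_add, add_mul, smul_mul_smul_comm, mul_sub, sub_mul, mul_one, one_mul]
    module
  rw [h1]
  simp only [mul_add, mul_sub R (_ + _), Matrix.mul_smul, trace_add, trace_sub R, trace_smul, trace_sub (_ + _),
    Complex.add_re, Complex.sub_re, smul_eq_mul, Complex.re_ofReal_mul]
  nlinarith [mul_nonneg (sq_nonneg (c - e)) h0]

lemma aux_deriv {m : Type*} [Fintype m] [DecidableEq m] (U V A : Matrix m m ℂ)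
    (hU : U * Uᴴ = 1) (hV : V * Vᴴ = 1) (p q : m → ℝ) (hA : IsTest A)
    (hp : ∀ i, 0 < p i) (hq : ∀ i, 0 < q i) (s : ℝ) (hs : 0 ≤ s) (a a' b b' : ℝ)
    (ha : ((U * diagonal (fun i => (p i : ℂ)) * Uᴴ * A).trace).re = a)
    (ha' : ((U * diagonal (fun i => (p i : ℂ)) * Uᴴ * (1 - A)).trace).re = a')
    (hb : ((V * diagonal (fun i => (q i : ℂ)) * Vᴴ * A).trace).re = b)
    (hb' : ((V * diagonal (fun i => (q i : ℂ)) * Vᴴ * (1 - A)).trace).re = b')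
    (hb0 : 0 < b) (hb0' : 0 < b') :
    a ^ 2 / (b + s * a) + a' ^ 2 / (b' + s * a') ≤
    ∑ i, ∑ j, Complex.normSq ((Uᴴ * V) i j) * ((p i) ^ 2 / (q j + s * p i)) := by
  have ha0 : 0 ≤ a := ha ▸ aux_trace_nonneg U _ p hp hA.1
  have ha0' : 0 ≤ a' := ha' ▸ aux_trace_nonneg U _ p hp hA.2
  have d1 : 0 < b + s * a := by positivity
  have d2 : 0 < b' + s * a' := by positivity
  obtain ⟨c, hc⟩ : ∃ c, c = a / (b + s * a) := ⟨_, rfl⟩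
  obtain ⟨e, he⟩ : ∃ e, e = a' / (b' + s * a') := ⟨_, rfl⟩
  have hX : ((c : ℂ) • A + (e : ℂ) • (1 - A))ᴴ = ((c : ℂ) • A + (e : ℂ) • (1 - A)) := by
    rw [conjTranspose_add, conjTranspose_smul, conjTranspose_smul, hA.1.1.eq, hA.2.1.eq]
    simp
  have h := aux_var U V _ hU hV p q hX hp hq s hs
  have h1 := aux_sq_bound U A p hp hA c e
  have h2 := aux_sq_bound V A q hq hA c e
  have h3 : ((U * diagonal (fun i => (p i : ℂ)) * Uᴴ *
      ((c : ℂ) • A + (e : ℂ) • (1 - A))).trace).re = c * a + e * a' := by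
    rw [mul_add, Matrix.mul_smul, Matrix.mul_smul, trace_add, trace_smul, trace_smul,
      Complex.add_re, smul_eq_mul, smul_eq_mul, Complex.re_ofReal_mul, Complex.re_ofReal_mul,
      ha, ha']
  rw [h3] at h
  rw [ha, ha'] at h1
  rw [hb, hb'] at h2
  have h4 := mul_le_mul_of_nonneg_left h1 hs
  have e1 : a ^ 2 / (b + s * a) = 2 * (c * a) - c ^ 2 * (b + s * a) := by
    rw [hc]; field_simp; ring
  have e2 : a' ^ 2 / (b' + s * a') = 2 * (e * a') - e ^ 2 * (b' + s * a') := by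
    rw [he]; field_simp; ring
  rw [e1, e2]
  linarith

lemma aux_hasDeriv (p q s : ℝ) (hp : 0 ≤ p) (hq : 0 < q) (hs : 0 ≤ s) :
    HasDerivAt (fun s => p * (Real.log (q + s * p) - Real.log p)) (p ^ 2 / (q + s * p)) s := by
  have d : q + s * p ≠ 0 := by positivity
  have h1 : HasDerivAt (fun s => q + s * p) p s := by
    simpa using ((hasDerivAt_id s).mul_const p).const_add q
  have := ((h1.log d).sub_const (Real.log p)).const_mul p
  refine this.congr_deriv ?_
  rw [pow_two, mul_div_assoc]

lemma aux_lim (p q : ℝ) (hp : 0 ≤ p) (hq : 0 < q) :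
    Tendsto (fun s => p * (Real.log (q + s * p) - Real.log p) - p * Real.log s) atTop
      (nhds 0) := by
  rcases hp.eq_or_lt with rfl | hp
  · simp
  have h : Tendsto (fun s : ℝ => p * Real.log (q / p * s⁻¹ + 1)) atTop (nhds 0) := by
    have h1 : Tendsto (fun s : ℝ => q / p * s⁻¹ + 1) atTop (nhds (q / p * 0 + 1)) :=
      (tendsto_inv_atTop_zero.const_mul _).add_const _
    have h2 := (h1.log (by simp)).const_mul p
    simpa using h2
  refine h.congr' ?_
  filter_upwards [eventually_gt_atTop (0 : ℝ)] with s hs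
  have : q / p * s⁻¹ + 1 = (q + s * p) / p / s := by field_simp
  rw [this, Real.log_div (by positivity) hs.ne', Real.log_div (by positivity) hp.ne']
  ring

lemma aux_core {m : Type*} [Fintype m] [DecidableEq m] (U V A : Matrix m m ℂ)
    (hU : U * Uᴴ = 1) (hV : V * Vᴴ = 1) (p q : m → ℝ) (hA : IsTest A)
    (hp : ∀ i, 0 < p i) (hq : ∀ i, 0 < q i) (a a' b b' : ℝ)
    (ha : ((U * diagonal (fun i => (p i : ℂ)) * Uᴴ * A).trace).re = a)
    (ha' : ((U * diagonal (fun i => (p i : ℂ)) * Uᴴ * (1 - A)).trace).re = a')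
    (hb : ((V * diagonal (fun i => (q i : ℂ)) * Vᴴ * A).trace).re = b)
    (hb' : ((V * diagonal (fun i => (q i : ℂ)) * Vᴴ * (1 - A)).trace).re = b')
    (hb0 : 0 < b) (hb0' : 0 < b')
    (hw : ∑ i, ∑ j, Complex.normSq ((Uᴴ * V) i j) * p i = a + a') :
    a * (Real.log a - Real.log b) + a' * (Real.log a' - Real.log b') ≤
    ∑ i, ∑ j, Complex.normSq ((Uᴴ * V) i j) * (p i * (Real.log (p i) - Real.log (q j))) := by
  have ha0 : 0 ≤ a := ha ▸ aux_trace_nonneg U _ p hp hA.1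
  have ha0' : 0 ≤ a' := ha' ▸ aux_trace_nonneg U _ p hp hA.2
  set G : ℝ → ℝ := fun s => (∑ i, ∑ j, Complex.normSq ((Uᴴ * V) i j) *
      (p i * (Real.log (q j + s * p i) - Real.log (p i))))
      - a * (Real.log (b + s * a) - Real.log a) - a' * (Real.log (b' + s * a') - Real.log a')
    with hG
  have hder : ∀ s, 0 ≤ s → HasDerivAt G ((∑ i, ∑ j, Complex.normSq ((Uᴴ * V) i j) *
      ((p i) ^ 2 / (q j + s * p i))) - a ^ 2 / (b + s * a) - a' ^ 2 / (b' + s * a')) s := by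
    intro s hs
    refine ((HasDerivAt.fun_sum fun i _ => HasDerivAt.fun_sum fun j _ => ?_).sub
      (aux_hasDeriv a b s ha0 hb0 hs)).sub (aux_hasDeriv a' b' s ha0' hb0' hs)
    exact (aux_hasDeriv (p i) (q j) s (hp i).le (hq j) hs).const_mul _
  have hmono : MonotoneOn G (Set.Ici 0) := by
    apply monotoneOn_of_deriv_nonneg (convex_Ici 0)
    · exact fun s hs => (hder s hs).continuousAt.continuousWithinAt
    · intro s hs
      rw [interior_Ici] at hs
      exact (hder s (le_of_lt hs)).differentiableAt.differentiableWithinAt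
    · intro s hs
      rw [interior_Ici] at hs
      rw [(hder s (le_of_lt hs)).deriv]
      have := aux_deriv U V A hU hV p q hA hp hq s (le_of_lt hs) a a' b b' ha ha' hb hb' hb0 hb0'
      linarith
  have hlim : Tendsto G atTop (nhds 0) := by
    have h1 : Tendsto (fun s : ℝ => (∑ i, ∑ j, Complex.normSq ((Uᴴ * V) i j) *
      (p i * (Real.log (q j + s * p i) - Real.log (p i)) - p i * Real.log s))
      - (a * (Real.log (b + s * a) - Real.log a) - a * Real.log s)
      - (a' * (Real.log (b' + s * a') - Real.log a') - a' * Real.log s)) atTop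
      (nhds ((∑ i, ∑ j, Complex.normSq ((Uᴴ * V) i j) * 0) - 0 - 0)) := by
      refine ((tendsto_finsetSum _ fun i _ => tendsto_finsetSum _ fun j _ => ?_).sub
        (aux_lim a b ha0 hb0)).sub (aux_lim a' b' ha0' hb0')
      exact (aux_lim (p i) (q j) (hp i).le (hq j)).const_mul _
    simp only [mul_zero, Finset.sum_const_zero, sub_zero] at h1
    refine h1.congr fun s => ?_
    simp only [mul_sub _ (_ * (_ - _)), Finset.sum_sub_distrib, hG]
    have : ∑ i, ∑ j, Complex.normSq ((Uᴴ * V) i j) * (p i * Real.log s) =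
        (a + a') * Real.log s := by
      rw [← hw]; simp only [Finset.sum_mul, mul_assoc]
    rw [this]; ring
  have h0 : G 0 ≤ 0 := by
    refine ge_of_tendsto hlim ?_
    filter_upwards [eventually_ge_atTop (0 : ℝ)] with s hs
    exact hmono (Set.mem_Ici.2 le_rfl) hs hs
  have h1 : ∑ i, ∑ j, Complex.normSq ((Uᴴ * V) i j) * (p i * (Real.log (p i) - Real.log (q j)))
    = - ∑ i, ∑ j, Complex.normSq ((Uᴴ * V) i j) * (p i * (Real.log (q j) - Real.log (p i))) := by
    simp only [← Finset.sum_neg_distrib]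
    refine Finset.sum_congr rfl fun i _ => Finset.sum_congr rfl fun j _ => ?_
    ring
  simp only [hG, zero_mul, add_zero] at h0
  rw [h1]
  linarith

lemma aux_rowsum {m : Type*} [Fintype m] [DecidableEq m] (U V : Matrix m m ℂ)
    (hU : Uᴴ * U = 1) (hV : V * Vᴴ = 1) (i : m) :
    ∑ j, Complex.normSq ((Uᴴ * V) i j) = 1 := by
  have h : (Uᴴ * V) * (Uᴴ * V)ᴴ = 1 := by
    rw [conjTranspose_mul, conjTranspose_conjTranspose, Matrix.mul_assoc, ← Matrix.mul_assoc V,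
      hV, Matrix.one_mul, hU]
  have h2 := congrFun (congrFun h i) i
  rw [Matrix.mul_apply, one_apply_eq] at h2
  have h3 := congrArg Complex.re h2
  rw [Complex.re_sum, Complex.one_re] at h3
  rw [← h3]
  refine Finset.sum_congr rfl fun j _ => ?_
  rw [conjTranspose_apply, ← starRingEnd_apply, Complex.mul_conj, Complex.ofReal_re]

/-- From the binary bound to the final form. -/
lemma aux_final (a b D : ℝ) (ha0 : 0 ≤ a) (ha1 : a ≤ 1) (hb0 : 0 < b) (hb1 : b < 1)
    (h : a * (Real.log a - Real.log b) + (1 - a) * (Real.log (1 - a) - Real.log (1 - b)) ≤ D) :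
    -Real.log 2 - a * Real.log b ≤ D := by
  have h1 := Real.binEntropy_le_log_two (p := a)
  rw [Real.binEntropy, Real.log_inv, Real.log_inv] at h1
  have h2 : Real.log (1 - b) ≤ 0 := Real.log_nonpos (by linarith) (by linarith)
  nlinarith

lemma aux_tp_mul {d : ℕ} (M N : Matrix (Fin d) (Fin d) ℂ) (n : ℕ) :
    tensorPow (M * N) n = tensorPow M n * tensorPow N n := by
  ext x y
  simp only [tensorPow, Matrix.mul_apply, ← Finset.prod_mul_distrib]
  rw [Finset.prod_univ_sum]
  simp

lemma aux_tp_conj {d : ℕ} (M : Matrix (Fin d) (Fin d) ℂ) (n : ℕ) :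
    tensorPow Mᴴ n = (tensorPow M n)ᴴ := by
  ext x y
  simp [tensorPow, conjTranspose_apply]

lemma aux_tp_diag {d : ℕ} (f : Fin d → ℝ) (n : ℕ) :
    tensorPow (diagonal (fun i => (f i : ℂ))) n =
      diagonal (fun x : Fin n → Fin d => ((∏ i, f (x i) : ℝ) : ℂ)) := by
  ext x y
  by_cases h : x = y
  · subst h; simp [tensorPow]
  · rw [diagonal_apply_ne _ h]
    obtain ⟨i, hi⟩ := Function.ne_iff.1 h
    exact Finset.prod_eq_zero (Finset.mem_univ i) (diagonal_apply_ne _ hi)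

lemma aux_tp_one {d : ℕ} (n : ℕ) :
    tensorPow (1 : Matrix (Fin d) (Fin d) ℂ) n = 1 := by
  have := aux_tp_diag (d := d) (fun _ => 1) n
  simpa using this

lemma aux_tp_trace {d : ℕ} (M : Matrix (Fin d) (Fin d) ℂ) (n : ℕ) :
    (tensorPow M n).trace = M.trace ^ n := by
  simp only [trace, diag, tensorPow]
  have := (Finset.prod_univ_sum (fun _ : Fin n => (Finset.univ : Finset (Fin d)))
    (fun _ j => M j j)).symm
  simpa using this

lemma aux_sum_pow {ι : Type*} [Fintype ι] [DecidableEq ι] (f g : ι → ℝ) (hf : ∑ i, f i = 1)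
    (n : ℕ) :
    ∑ x : Fin n → ι, (∏ k, f (x k)) * ∑ k, g (x k) = n * ∑ i, f i * g i := by
  simp only [Finset.mul_sum]
  rw [Finset.sum_comm]
  have : ∀ k : Fin n, ∑ x : Fin n → ι, (∏ l, f (x l)) * g (x k) = ∑ i, f i * g i := by
    intro k
    have h := Finset.prod_univ_sum (fun _ : Fin n => (Finset.univ : Finset ι))
      (fun l j => f j * if l = k then g j else 1)
    rw [Fintype.piFinset_univ] at h
    simp only [Finset.prod_mul_distrib, Finset.prod_ite_eq', Finset.mem_univ, if_true] at h
    rw [← h, Finset.prod_eq_single k]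
    · simp
    · intro l _ hl
      simp [hl, hf]
    · simp
  simp only [this, Finset.sum_const, Finset.card_univ, Fintype.card_fin, nsmul_eq_mul,
    Finset.mul_sum]

lemma aux_sum_pow2 {ι κ : Type*} [Fintype ι] [DecidableEq ι] [Fintype κ] [DecidableEq κ]
    (f g : ι → κ → ℝ) (hf : ∑ i, ∑ j, f i j = 1) (n : ℕ) :
    ∑ x : Fin n → ι, ∑ y : Fin n → κ, (∏ k, f (x k) (y k)) * ∑ k, g (x k) (y k) =
      n * ∑ i, ∑ j, f i j * g i j := by
  have h := aux_sum_pow (fun z : ι × κ => f z.1 z.2) (fun z => g z.1 z.2)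
    (by rw [Fintype.sum_prod_type]; exact hf) n
  rw [Fintype.sum_prod_type (fun z : ι × κ => f z.1 z.2 * g z.1 z.2)] at h
  rw [← h, ← Fintype.sum_prod_type']
  exact (Equiv.sum_comp (Equiv.arrowProdEquivProdArrow (Fin n) (fun _ => ι) (fun _ => κ)) _).symm

lemma aux_relEnt {m : Type*} [Fintype m] [DecidableEq m] (ρ σ : Matrix m m ℂ)
    (U V : Matrix m m ℂ) (p q : m → ℝ) (hU : Uᴴ * U = 1) (hU' : U * Uᴴ = 1) (hV : V * Vᴴ = 1)
    (hρ : ρ = U * diagonal (fun i => (p i : ℂ)) * Uᴴ)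
    (hlρ : matLog ρ = U * diagonal (fun i => (Real.log (p i) : ℂ)) * Uᴴ)
    (hlσ : matLog σ = V * diagonal (fun i => (Real.log (q i) : ℂ)) * Vᴴ) :
    relEnt ρ σ = ∑ i, ∑ j, Complex.normSq ((Uᴴ * V) i j) *
      (p i * (Real.log (p i) - Real.log (q j))) := by
  have h1 : ((ρ * matLog ρ).trace).re = ∑ i, p i * Real.log (p i) := by
    have : ρ * matLog ρ = U * (diagonal (fun i => (p i : ℂ)) *
        diagonal (fun i => (Real.log (p i) : ℂ)) * Uᴴ) := by
      rw [hlρ, hρ]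
      simp only [Matrix.mul_assoc]
      rw [← Matrix.mul_assoc Uᴴ U, hU, Matrix.one_mul]
    rw [this, trace_mul_comm, Matrix.mul_assoc, hU, Matrix.mul_one, diagonal_mul_diagonal,
      trace_diagonal, Complex.re_sum]
    refine Finset.sum_congr rfl fun i _ => ?_
    rw [Complex.re_ofReal_mul, Complex.ofReal_re]
  have h2 : ((ρ * matLog σ).trace).re = ∑ i, ∑ j, Complex.normSq ((Uᴴ * V) i j) *
      (p i * Real.log (q j)) := by
    have : (ρ * matLog σ).trace = (diagonal (fun i => (p i : ℂ)) *
        ((Uᴴ * V) * diagonal (fun i => (Real.log (q i) : ℂ)) * (Uᴴ * V)ᴴ)).trace := by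
      rw [hlσ, hρ, conjTranspose_mul, conjTranspose_conjTranspose, Matrix.mul_assoc,
        Matrix.mul_assoc, Matrix.trace_mul_comm]
      simp only [Matrix.mul_assoc]
    rw [this]
    simp only [trace, diag, diagonal_mul, Complex.re_sum, Complex.re_ofReal_mul]
    refine Finset.sum_congr rfl fun i _ => ?_
    rw [Matrix.mul_apply, Complex.re_sum, Finset.mul_sum]
    refine Finset.sum_congr rfl fun j _ => ?_
    rw [mul_diagonal, conjTranspose_apply, ← starRingEnd_apply, mul_right_comm,
      Complex.mul_conj, Complex.re_ofReal_mul, Complex.ofReal_re]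
    ring
  rw [relEnt, Matrix.mul_sub, trace_sub, Complex.sub_re, h1, h2]
  simp only [mul_sub, Finset.sum_sub_distrib, ← Finset.sum_mul, aux_rowsum U V hU hV, one_mul]

/-- **Relative entropy lower bound from a test.** For any test `A_n` with
`0 < β_n(A_n) < 1` and `0 ≤ α_n(A_n) ≤ 1`,
`D(ρ‖σ) ≥ −(log 2)/n − (1 − α_n(A_n)) (1/n) log β_n(A_n)`. -/
theorem relEnt_lower_bound_from_test {d : ℕ} (hd : 0 < d)
    (ρ σ : Matrix (Fin d) (Fin d) ℂ)
    (hρ : IsDensity ρ) (hσ : IsDensity σ) (hρpd : ρ.PosDef) (hσpd : σ.PosDef)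
    (n : ℕ) (hn : 1 ≤ n) (A : Matrix (Fin n → Fin d) (Fin n → Fin d) ℂ) (hA : IsTest A)
    (hβ0 : 0 < betaErr σ n A) (hβ1 : betaErr σ n A < 1)
    (hα0 : 0 ≤ alphaErr ρ n A) (hα1 : alphaErr ρ n A ≤ 1) :
    relEnt ρ σ ≥ -(Real.log 2) / (n : ℝ)
      - (1 - alphaErr ρ n A) * ((1 / (n : ℝ)) * Real.log (betaErr σ n A)) := by
  have hHρ := hρpd.1
  have hHσ := hσpd.1
  obtain ⟨U, hUdef⟩ : ∃ U : Matrix (Fin d) (Fin d) ℂ, U = hHρ.eigenvectorUnitary := ⟨_, rfl⟩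
  obtain ⟨V, hVdef⟩ : ∃ V : Matrix (Fin d) (Fin d) ℂ, V = hHσ.eigenvectorUnitary := ⟨_, rfl⟩
  obtain ⟨p, hpdef⟩ : ∃ p : Fin d → ℝ, p = hHρ.eigenvalues := ⟨_, rfl⟩
  obtain ⟨q, hqdef⟩ : ∃ q : Fin d → ℝ, q = hHσ.eigenvalues := ⟨_, rfl⟩
  have hU1 : U * Uᴴ = 1 := by
    rw [hUdef]; exact Unitary.mul_star_self_of_mem hHρ.eigenvectorUnitary.2
  have hU2 : Uᴴ * U = 1 := by
    rw [hUdef]; exact Unitary.star_mul_self_of_mem hHρ.eigenvectorUnitary.2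
  have hV1 : V * Vᴴ = 1 := by
    rw [hVdef]; exact Unitary.mul_star_self_of_mem hHσ.eigenvectorUnitary.2
  have hp : ∀ i, 0 < p i := by rw [hpdef]; exact hρpd.eigenvalues_pos
  have hq : ∀ i, 0 < q i := by rw [hqdef]; exact hσpd.eigenvalues_pos
  have hρd : ρ = U * diagonal (fun i => (p i : ℂ)) * Uᴴ := by
    rw [hUdef, hpdef]; exact hHρ.spectral_theorem
  have hσd : σ = V * diagonal (fun i => (q i : ℂ)) * Vᴴ := by
    rw [hVdef, hqdef]; exact hHσ.spectral_theorem
  have hlρ : matLog ρ = U * diagonal (fun i => (Real.log (p i) : ℂ)) * Uᴴ := by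
    rw [matLog, matFun, dif_pos hHρ, hUdef, hpdef]; rfl
  have hlσ : matLog σ = V * diagonal (fun i => (Real.log (q i) : ℂ)) * Vᴴ := by
    rw [matLog, matFun, dif_pos hHσ, hVdef, hqdef]; rfl
  have hD := aux_relEnt ρ σ U V p q hU2 hU1 hV1 hρd hlρ hlσ
  have htp : ∀ (W : Matrix (Fin d) (Fin d) ℂ) (r : Fin d → ℝ),
      tensorPow (W * diagonal (fun i => (r i : ℂ)) * Wᴴ) n =
      tensorPow W n * diagonal (fun x : Fin n → Fin d => ((∏ i, r (x i) : ℝ) : ℂ)) *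
        (tensorPow W n)ᴴ := by
    intro W r
    rw [aux_tp_mul, aux_tp_mul, aux_tp_conj, aux_tp_diag]
  have hρn := htp U p
  have hσn := htp V q
  rw [← hρd] at hρn
  rw [← hσd] at hσn
  have hUn : tensorPow U n * (tensorPow U n)ᴴ = 1 := by
    rw [← aux_tp_conj, ← aux_tp_mul, hU1, aux_tp_one]
  have hVn : tensorPow V n * (tensorPow V n)ᴴ = 1 := by
    rw [← aux_tp_conj, ← aux_tp_mul, hV1, aux_tp_one]
  have hUn2 : (tensorPow U n)ᴴ * tensorPow U n = 1 := by
    rw [← aux_tp_conj, ← aux_tp_mul, hU2, aux_tp_one]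
  have htr : ∀ τ : Matrix (Fin d) (Fin d) ℂ, τ.trace = 1 →
      ((tensorPow τ n * (1 - A)).trace).re = 1 - ((tensorPow τ n * A).trace).re := by
    intro τ hτ
    rw [Matrix.mul_sub, trace_sub, Matrix.mul_one, aux_tp_trace, hτ, one_pow, Complex.sub_re,
      Complex.one_re]
  have hpsum : ∑ i, p i = 1 := by
    have h := hρ.2
    rw [hρd, Matrix.mul_assoc, trace_mul_comm, Matrix.mul_assoc, hU2, Matrix.mul_one,
      trace_diagonal] at h
    exact_mod_cast h
  have hsum1 : ∑ i, ∑ j, Complex.normSq ((Uᴴ * V) i j) * p i = 1 := by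
    simp only [← Finset.sum_mul, aux_rowsum U V hU2 hV1, one_mul, hpsum]
  have hwn : ∀ x y, Complex.normSq (((tensorPow U n)ᴴ * tensorPow V n) x y) =
      ∏ k, Complex.normSq ((Uᴴ * V) (x k) (y k)) := by
    intro x y
    rw [← aux_tp_conj, ← aux_tp_mul, tensorPow, map_prod]
  have hpn : ∀ x : Fin n → Fin d, 0 < ∏ i, p (x i) := fun x =>
    Finset.prod_pos fun i _ => hp _
  have hqn : ∀ x : Fin n → Fin d, 0 < ∏ i, q (x i) := fun x =>
    Finset.prod_pos fun i _ => hq _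
  have hα : alphaErr ρ n A = 1 - ((tensorPow ρ n * A).trace).re := htr ρ hρ.2
  obtain ⟨a, ha⟩ : ∃ a, ((tensorPow ρ n * A).trace).re = a := ⟨_, rfl⟩
  obtain ⟨b, hb⟩ : ∃ b, betaErr σ n A = b := ⟨_, rfl⟩
  have ha' := htr ρ hρ.2
  have hb' := htr σ hσ.2
  have hb2 : ((tensorPow σ n * A).trace).re = b := hb
  rw [ha] at ha' hα
  rw [hb2] at hb'
  rw [hα] at hα0 hα1
  rw [hb] at hβ0 hβ1
  have hpnsum : ∑ x : Fin n → Fin d, ∏ i, p (x i) = 1 := by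
    have := (Finset.prod_univ_sum (fun _ : Fin n => (Finset.univ : Finset (Fin d)))
      (fun _ j => p j)).symm
    simpa [hpsum] using this
  rw [hρn] at ha ha'
  rw [hσn] at hb2 hb'
  have core := aux_core (tensorPow U n) (tensorPow V n) A hUn hVn _ _ hA hpn hqn a (1 - a) b
    (1 - b) ha ha' hb2 hb' hβ0 (by linarith) (by
      simp only [← Finset.sum_mul, aux_rowsum _ _ hUn2 hVn, one_mul, hpnsum]
      ring)
  have hDn : ∑ x, ∑ y, Complex.normSq (((tensorPow U n)ᴴ * tensorPow V n) x y) *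
      ((∏ i, p (x i)) * (Real.log (∏ i, p (x i)) - Real.log (∏ i, q (y i)))) =
      n * relEnt ρ σ := by
    have h := aux_sum_pow2 (fun i j => Complex.normSq ((Uᴴ * V) i j) * p i)
      (fun i j => Real.log (p i) - Real.log (q j)) hsum1 n
    rw [hD]
    simp only [mul_assoc] at h
    rw [← h]
    refine Finset.sum_congr rfl fun x _ => Finset.sum_congr rfl fun y _ => ?_
    rw [hwn, Real.log_prod (fun i _ => (hp _).ne'), Real.log_prod (fun i _ => (hq _).ne'),
      Finset.prod_mul_distrib, Finset.sum_sub_distrib, mul_assoc]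
  rw [hDn] at core
  have fin := aux_final a b _ (by linarith) (by linarith) hβ0 hβ1 core
  have hn0 : (0 : ℝ) < n := by exact_mod_cast hn
  rw [hα, hb, ge_iff_le]
  have e : -(Real.log 2) / (n : ℝ) - (1 - (1 - a)) * ((1 / (n : ℝ)) * Real.log b) =
      (-Real.log 2 - a * Real.log b) / n := by
    field_simp
    ring
  rw [e, div_le_iff₀ hn0]
  linarith

end
end

section
/- (Intermediate trace bound.) For every real a, every n ≥ 1, and every s with 0 ≤ s ≤ 1, the test S̄_n(a) = {E_{σ_n}(ρ_n) − e^{na} σ_n > 0} satisfies Tr[ρ_n (I − S̄_n(a))] ≤ e^{nas} · Tr[E_{σ_n}(ρ_n)^{1−s} σ_n^{s}]. -/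
open Matrix Filter
open scoped ComplexOrder

noncomputable section

theorem itb_tensorPow_mul {d : ℕ} (A B : Matrix (Fin d) (Fin d) ℂ) (n : ℕ) :
    tensorPow (A * B) n = tensorPow A n * tensorPow B n := by
  ext x y
  simp only [tensorPow, Matrix.mul_apply, ← Finset.prod_mul_distrib]
  rw [Fintype.prod_sum]

theorem itb_tensorPow_conjTranspose {d : ℕ} (A : Matrix (Fin d) (Fin d) ℂ) (n : ℕ) :
    tensorPow Aᴴ n = (tensorPow A n)ᴴ := by
  ext x y
  simp [tensorPow, Matrix.conjTranspose_apply]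

open scoped MatrixOrder in
theorem itb_tensorPow_posSemidef {d : ℕ} (A : Matrix (Fin d) (Fin d) ℂ) (hA : A.PosSemidef)
    (n : ℕ) : (tensorPow A n).PosSemidef := by
  obtain ⟨B, hB⟩ := CStarAlgebra.nonneg_iff_eq_star_mul_self.mp hA.nonneg
  rw [hB, itb_tensorPow_mul, Matrix.star_eq_conjTranspose, itb_tensorPow_conjTranspose]
  exact Matrix.posSemidef_conjTranspose_mul_self _

theorem itb_diag_hermitian {m : Type*} [Fintype m] [DecidableEq m] (U : Matrix m m ℂ)
    (p : m → ℝ) :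
    (U * Matrix.diagonal (fun i => (p i : ℂ)) * star U).IsHermitian := by
  rw [Matrix.star_eq_conjTranspose]
  apply Matrix.isHermitian_mul_mul_conjTranspose
  simp [Matrix.IsHermitian, Matrix.diagonal_conjTranspose, Pi.star_def]

/-- The functional calculus does not depend on the diagonalization. -/
theorem itb_matFun_eq {m : Type*} [Fintype m] [DecidableEq m] (f : ℝ → ℝ) (U : Matrix m m ℂ)
    (h1 : star U * U = 1) (h2 : U * star U = 1) (p : m → ℝ) :
    matFun f (U * Matrix.diagonal (fun i => (p i : ℂ)) * star U) =
      U * Matrix.diagonal (fun i => (f (p i) : ℂ)) * star U := by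
  have hA := itb_diag_hermitian U p
  have hspec := hA.spectral_theorem
  rw [Unitary.conjStarAlgAut_apply] at hspec
  unfold matFun
  rw [dif_pos hA]
  have hV1 : star (hA.eigenvectorUnitary : Matrix m m ℂ) * (hA.eigenvectorUnitary : Matrix m m ℂ)
    = 1 := Unitary.coe_star_mul_self _
  have hV2 : (hA.eigenvectorUnitary : Matrix m m ℂ) * star (hA.eigenvectorUnitary : Matrix m m ℂ)
    = 1 := Unitary.coe_mul_star_self _
  generalize (hA.eigenvectorUnitary : Matrix m m ℂ) = V at *
  generalize hA.eigenvalues = e at *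
  have hW : Matrix.diagonal (fun i => (e i : ℂ)) * (star V * U) =
      (star V * U) * Matrix.diagonal (fun i => (p i : ℂ)) := by
    calc Matrix.diagonal (fun i => (e i : ℂ)) * (star V * U)
        = star V * V * (Matrix.diagonal (fun i => (e i : ℂ)) * (star V * U)) := by
          rw [hV1, one_mul]
      _ = star V * (V * Matrix.diagonal (fun i => (e i : ℂ)) * star V) * U := by noncomm_ring
      _ = star V * (U * Matrix.diagonal (fun i => (p i : ℂ)) * star U) * U := by
          rw [hspec]; rfl
      _ = star V * U * Matrix.diagonal (fun i => (p i : ℂ)) * (star U * U) := by noncomm_ring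
      _ = _ := by rw [h1, mul_one]
  have hfW : Matrix.diagonal (fun i => (f (e i) : ℂ)) * (star V * U) =
      (star V * U) * Matrix.diagonal (fun i => (f (p i) : ℂ)) := by
    ext i j
    have := congrFun (congrFun hW i) j
    rw [Matrix.diagonal_mul, Matrix.mul_diagonal] at this ⊢
    by_cases h : e i = p j
    · rw [h, mul_comm]
    · have h0 : (star V * U) i j = 0 := by
        have h' : ((e i : ℂ) - p j) * (star V * U) i j = 0 := by
          rw [sub_mul, this]; ring
        rcases mul_eq_zero.mp h' with h'' | h''
        · exact absurd (by exact_mod_cast sub_eq_zero.mp h'') h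
        · exact h''
      rw [h0]; simp
  calc V * Matrix.diagonal (fun i => (f (e i) : ℂ)) * star V
      = V * Matrix.diagonal (fun i => (f (e i) : ℂ)) * star V * (U * star U) := by
        rw [h2, mul_one]
    _ = V * (Matrix.diagonal (fun i => (f (e i) : ℂ)) * (star V * U)) * star U := by noncomm_ring
    _ = (V * star V) * (U * Matrix.diagonal (fun i => (f (p i) : ℂ)) * star U) := by
        rw [hfW]; noncomm_ring
    _ = _ := by rw [hV2, one_mul]

/-- Commuting symmetric operators have a joint orthonormal eigenbasis. -/
theorem itb_basis {m E : Type*} [Fintype m] [NormedAddCommGroup E] [InnerProductSpace ℂ E]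
    [FiniteDimensional ℂ E] (A B : E →ₗ[ℂ] E) (hA : A.IsSymmetric) (hB : B.IsSymmetric)
    (hc : Commute A B) (hm : Module.finrank ℂ E = Fintype.card m) :
    ∃ b : OrthonormalBasis m ℂ E, ∀ j, ∃ μ : ℂ × ℂ, A (b j) = μ.2 • b j ∧ B (b j) = μ.1 • b j := by
  classical
  have hint := hA.directSum_isInternal_of_commute hB hc
  have horth := hA.orthogonalFamily_eigenspace_inf_eigenspace hB
  generalize hV : (fun i : ℂ × ℂ => (Module.End.eigenspace A i.2 ⊓
      Module.End.eigenspace B i.1 : Submodule ℂ E)) = V at hint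
  have horth2 : OrthogonalFamily ℂ (fun i => V i) fun i => (V i).subtypeₗᵢ := by
    subst hV; exact horth
  have hint' := DirectSum.isInternal_ne_bot_iff.mpr hint
  have horth' : OrthogonalFamily ℂ (fun i : {i // V i ≠ ⊥} => V i)
      fun i => (V i).subtypeₗᵢ :=
    horth2.comp (f := fun i : {i // V i ≠ ⊥} => i.1) Subtype.val_injective
  let _ := iSupIndep.fintypeNeBotOfFiniteDimensional hint.submodule_iSupIndep
  let e : Fin (Fintype.card m) ≃ m := Fintype.equivOfCardEq (Fintype.card_fin _)
  refine ⟨(hint'.subordinateOrthonormalBasis hm horth').reindex e, fun j => ?_⟩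
  have h := hint'.subordinateOrthonormalBasis_subordinate hm (e.symm j) horth'
  rw [OrthonormalBasis.reindex_apply]
  generalize hint'.subordinateOrthonormalBasisIndex hm (e.symm j) horth' = k at h
  refine ⟨k.1, ?_⟩
  subst hV
  obtain ⟨h1, h2⟩ := Submodule.mem_inf.mp h
  exact ⟨Module.End.mem_eigenspace_iff.mp h1, Module.End.mem_eigenspace_iff.mp h2⟩

/-- Commuting Hermitian matrices are simultaneously diagonalizable. -/
theorem itb_simul {m : Type*} [Fintype m] [DecidableEq m] (A B : Matrix m m ℂ)
    (hA : A.IsHermitian) (hB : B.IsHermitian) (hAB : Commute A B) :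
    ∃ (U : Matrix m m ℂ) (p q : m → ℝ), star U * U = 1 ∧ U * star U = 1 ∧
      A = U * Matrix.diagonal (fun i => (p i : ℂ)) * star U ∧
      B = U * Matrix.diagonal (fun i => (q i : ℂ)) * star U := by
  classical
  have hAs := Matrix.isSymmetric_toEuclideanLin_iff.mpr hA
  have hBs := Matrix.isSymmetric_toEuclideanLin_iff.mpr hB
  have hc : Commute (Matrix.toEuclideanLin A) (Matrix.toEuclideanLin B) := by
    have h := hAB.eq
    apply LinearMap.ext
    intro x
    simp only [Module.End.mul_apply, Matrix.toLpLin_apply, Matrix.mulVec_mulVec, h]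
  obtain ⟨b, hb'⟩ := itb_basis (m := m) _ _ hAs hBs hc finrank_euclideanSpace
  have hb : ∀ j, ∃ μ : ℂ × ℂ, A *ᵥ (b j).ofLp = μ.2 • (b j).ofLp ∧
      B *ᵥ (b j).ofLp = μ.1 • (b j).ofLp := by
    intro j
    obtain ⟨μ, h1, h2⟩ := hb' j
    refine ⟨μ, ?_, ?_⟩
    · have := congrArg WithLp.ofLp h1
      simpa only [Matrix.toLpLin_apply] using! this
    · have := congrArg WithLp.ofLp h2
      simpa only [Matrix.toLpLin_apply] using! this
  choose μ hμA hμB using hb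
  let U : Matrix m m ℂ := Matrix.of fun i j => (b j).ofLp i
  have h1 : star U * U = 1 := by
    ext i j
    have := orthonormal_iff_ite.mp b.orthonormal i j
    rw [Matrix.one_apply, ← this]
    simp [U, Matrix.mul_apply, Matrix.star_apply, PiLp.inner_apply, mul_comm]
  have h2 : U * star U = 1 := mul_eq_one_comm.mp h1
  have key : ∀ (C : Matrix m m ℂ) (hC : C.IsHermitian) (ν : m → ℂ)
      (h : ∀ j, C *ᵥ (b j).ofLp = ν j • (b j).ofLp),
      C = U * Matrix.diagonal (fun i => ((ν i).re : ℂ)) * star U := by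
    intro C hC ν h
    have hCU : C * U = U * Matrix.diagonal ν := by
      ext i j
      have := congrFun (h j) i
      rw [Matrix.mul_diagonal, Matrix.mul_apply]
      simpa [Matrix.mulVec, dotProduct, U, mul_comm] using this
    have hD : star U * C * U = Matrix.diagonal ν := by
      rw [mul_assoc, hCU, ← mul_assoc, h1, one_mul]
    have hH : (Matrix.diagonal ν).IsHermitian := by
      rw [← hD, Matrix.star_eq_conjTranspose]
      exact Matrix.isHermitian_conjTranspose_mul_mul _ hC
    have hre : (fun i => ((ν i).re : ℂ)) = ν := by
      funext i
      have := hH.apply i i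
      simp only [Matrix.diagonal_apply_eq] at this
      exact Complex.conj_eq_iff_re.mp this
    rw [hre, ← hCU, mul_assoc, h2, mul_one]
  exact ⟨U, fun i => (μ i).2.re, fun i => (μ i).1.re, h1, h2, key A hA _ hμA, key B hB _ hμB⟩

theorem itb_diag_mul {m : Type*} [Fintype m] [DecidableEq m] (U : Matrix m m ℂ)
    (h1 : star U * U = 1) (D E : Matrix m m ℂ) :
    (U * D * star U) * (U * E * star U) = U * (D * E) * star U := by
  calc (U * D * star U) * (U * E * star U) = U * D * (star U * U) * E * star U := by noncomm_ring
    _ = _ := by rw [h1]; noncomm_ring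

theorem itb_exists_diag {m : Type*} [Fintype m] [DecidableEq m] (A : Matrix m m ℂ)
    (hA : A.IsHermitian) :
    ∃ (U : Matrix m m ℂ) , star U * U = 1 ∧ U * star U = 1 ∧
      A = U * Matrix.diagonal (fun i => (hA.eigenvalues i : ℂ)) * star U ∧
      ∀ f, matFun f A = U * Matrix.diagonal (fun i => (f (hA.eigenvalues i) : ℂ)) * star U := by
  refine ⟨hA.eigenvectorUnitary, Unitary.coe_star_mul_self _, Unitary.coe_mul_star_self _, ?_, ?_⟩
  · conv_lhs => rw [hA.spectral_theorem]
    rw [Unitary.conjStarAlgAut_apply]; rfl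
  · intro f
    rw [matFun, dif_pos hA]

theorem itb_specProj_herm {m : Type*} [Fintype m] [DecidableEq m] (A : Matrix m m ℂ) (hA : A.IsHermitian)
    (μ : ℝ) : (specProj A μ)ᴴ = specProj A μ := by
  obtain ⟨U, h1, h2, h3, h4⟩ := itb_exists_diag A hA
  rw [specProj, h4]
  exact itb_diag_hermitian U (fun i => if hA.eigenvalues i = μ then 1 else 0)

theorem itb_specProj_idem {m : Type*} [Fintype m] [DecidableEq m] (A : Matrix m m ℂ) (hA : A.IsHermitian)
    (μ : ℝ) : specProj A μ * specProj A μ = specProj A μ := by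
  obtain ⟨U, h1, h2, h3, h4⟩ := itb_exists_diag A hA
  rw [specProj, h4, itb_diag_mul U h1, Matrix.diagonal_mul_diagonal]
  congr 3
  funext i
  split_ifs <;> simp

theorem itb_mul_specProj {m : Type*} [Fintype m] [DecidableEq m] (A : Matrix m m ℂ) (hA : A.IsHermitian)
    (μ : ℝ) : A * specProj A μ = (μ : ℂ) • specProj A μ := by
  obtain ⟨U, h1, h2, h3, h4⟩ := itb_exists_diag A hA
  rw [specProj, h4]
  conv_lhs => enter [1]; rw [h3]
  rw [itb_diag_mul U h1, Matrix.diagonal_mul_diagonal, ← smul_mul_assoc, ← mul_smul_comm,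
    ← Matrix.diagonal_smul]
  congr 3
  funext i
  by_cases h : hA.eigenvalues i = μ <;> simp [h]

theorem itb_specProj_mul {m : Type*} [Fintype m] [DecidableEq m] (A : Matrix m m ℂ) (hA : A.IsHermitian)
    (μ : ℝ) : specProj A μ * A = (μ : ℂ) • specProj A μ := by
  have := congrArg Matrix.conjTranspose (itb_mul_specProj A hA μ)
  simpa [Matrix.conjTranspose_mul, itb_specProj_herm A hA, hA.eq] using this

theorem itb_sum_specProj {m : Type*} [Fintype m] [DecidableEq m] (A : Matrix m m ℂ) (hA : A.IsHermitian)
    : ∑ μ ∈ eigFinset A, specProj A μ = 1 := by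
  obtain ⟨U, h1, h2, h3, h4⟩ := itb_exists_diag A hA
  simp only [specProj, h4]
  rw [← Finset.sum_mul, ← Finset.mul_sum]
  have : ∑ μ ∈ eigFinset A, Matrix.diagonal
      (fun i => (((if hA.eigenvalues i = μ then 1 else 0 : ℝ)) : ℂ)) = 1 := by
    ext i j
    rw [Matrix.sum_apply]
    by_cases hij : i = j
    · subst hij
      have : hA.eigenvalues i ∈ eigFinset A := by
        rw [eigFinset, dif_pos hA]; simp
      simp only [Matrix.diagonal_apply_eq, ← Complex.ofReal_sum]
      simp [this]
    · simp [hij]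
  rw [this, mul_one, h2]

theorem itb_pinch_commute {m : Type*} [Fintype m] [DecidableEq m] (A : Matrix m m ℂ) (hA : A.IsHermitian)
    (B : Matrix m m ℂ) : Commute (pinch A B) A := by
  rw [pinch]
  apply Commute.sum_left
  intro μ _
  change _ = _
  rw [mul_assoc, itb_specProj_mul A hA, ← mul_assoc, ← mul_assoc, itb_mul_specProj A hA]
  simp

theorem itb_pinch_posSemidef {m : Type*} [Fintype m] [DecidableEq m] (A : Matrix m m ℂ) (hA : A.IsHermitian)
    (B : Matrix m m ℂ) (hB : B.PosSemidef) :
    (pinch A B).PosSemidef := by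
  rw [pinch]
  apply Matrix.posSemidef_sum
  intro μ _
  have := hB.mul_mul_conjTranspose_same (specProj A μ)
  rwa [itb_specProj_herm A hA] at this

theorem itb_pinch_trace {m : Type*} [Fintype m] [DecidableEq m] (A : Matrix m m ℂ) (hA : A.IsHermitian)
    (B X : Matrix m m ℂ) (hX : ∀ μ, Commute (specProj A μ) X) :
    (pinch A B * X).trace = (B * X).trace := by
  rw [pinch, Finset.sum_mul, Matrix.trace_sum]
  have : ∀ μ, (specProj A μ * B * specProj A μ * X).trace = (B * X * specProj A μ).trace := by
    intro μ
    rw [mul_assoc, mul_assoc, Matrix.trace_mul_comm, mul_assoc, (hX μ).eq, mul_assoc,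
      itb_specProj_idem A hA, ← mul_assoc]
  simp only [this]
  rw [← Matrix.trace_sum, ← Finset.mul_sum, itb_sum_specProj A hA, mul_one]

theorem itb_diag_nonneg {m : Type*} [Fintype m] [DecidableEq m] (U : Matrix m m ℂ)
    (h1 : star U * U = 1) (p : m → ℝ)
    (h : (U * Matrix.diagonal (fun i => (p i : ℂ)) * star U).PosSemidef) (i : m) : 0 ≤ p i := by
  have h' := h.conjTranspose_mul_mul_same U
  have e : Uᴴ * (U * Matrix.diagonal (fun i => (p i : ℂ)) * star U) * U =
      Matrix.diagonal (fun i => (p i : ℂ)) := by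
    rw [← Matrix.star_eq_conjTranspose]
    calc _ = (star U * U) * Matrix.diagonal (fun i => (p i : ℂ)) * (star U * U) := by noncomm_ring
      _ = _ := by rw [h1]; simp
  rw [e, Matrix.posSemidef_diagonal_iff] at h'
  exact_mod_cast h' i

theorem itb_diag_trace {m : Type*} [Fintype m] [DecidableEq m] (U : Matrix m m ℂ)
    (h1 : star U * U = 1) (p : m → ℝ) :
    (U * Matrix.diagonal (fun i => (p i : ℂ)) * star U).trace.re = ∑ i, p i := by
  rw [Matrix.trace_mul_comm, ← mul_assoc, h1, one_mul, Matrix.trace_diagonal]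
  simp

theorem itb_general {m : Type*} [Fintype m] [DecidableEq m] (R S : Matrix m m ℂ)
    (hR : R.PosSemidef) (hS : S.PosSemidef) (c s : ℝ) (hc : 0 < c) (hs0 : 0 ≤ s) (hs1 : s ≤ 1) :
    ((R * (1 - posProj (pinch S R - (c : ℂ) • S))).trace).re ≤
      c ^ s * ((matRPow (pinch S R) (1 - s) * matRPow S s).trace).re := by
  have hSH := hS.isHermitian
  have hP := itb_pinch_posSemidef S hSH R hR
  obtain ⟨U, p, q, h1, h2, hp, hq⟩ := itb_simul _ _ hP.isHermitian hSH (itb_pinch_commute S hSH R)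
  have hp0 : ∀ i, 0 ≤ p i := itb_diag_nonneg U h1 p (hp ▸ hP)
  have hq0 : ∀ i, 0 ≤ q i := itb_diag_nonneg U h1 q (hq ▸ hS)
  have hdiff : pinch S R - (c : ℂ) • S =
      U * Matrix.diagonal (fun i => ((p i - c * q i : ℝ) : ℂ)) * star U := by
    rw [hp]
    conv_lhs => enter [2, 2]; rw [hq]
    rw [← smul_mul_assoc, ← mul_smul_comm, ← sub_mul, ← mul_sub, ← Matrix.diagonal_smul,
      Matrix.diagonal_sub]
    congr 3
    funext i
    simp
  have hT : 1 - posProj (pinch S R - (c : ℂ) • S) =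
      U * Matrix.diagonal (fun i => ((if 0 < p i - c * q i then 0 else 1 : ℝ) : ℂ)) * star U := by
    rw [hdiff, posProj, itb_matFun_eq _ U h1 h2]
    have hone : (1 : Matrix m m ℂ) = U * 1 * star U := by rw [mul_one, h2]
    conv_lhs => enter [1]; rw [hone]
    rw [← sub_mul, ← mul_sub, ← Matrix.diagonal_one, Matrix.diagonal_sub]
    congr 3
    funext i
    split_ifs <;> simp
  have hcomm : ∀ μ, Commute (specProj S μ) (1 - posProj (pinch S R - (c : ℂ) • S)) := by
    intro μ
    rw [hT, specProj]
    conv => enter [1]; rw [hq]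
    rw [itb_matFun_eq _ U h1 h2]
    change _ = _
    rw [itb_diag_mul U h1, itb_diag_mul U h1, Matrix.diagonal_mul_diagonal,
      Matrix.diagonal_mul_diagonal]
    simp only [mul_comm]
  rw [← itb_pinch_trace S hSH R _ hcomm, hT, matRPow, matRPow]
  have hL : (pinch S R * (U * Matrix.diagonal
      (fun i => ((if 0 < p i - c * q i then 0 else 1 : ℝ) : ℂ)) * star U)).trace.re =
      ∑ i, p i * (if 0 < p i - c * q i then 0 else 1 : ℝ) := by
    rw [hp, itb_diag_mul U h1, Matrix.diagonal_mul_diagonal, ← itb_diag_trace U h1]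
    simp only [Complex.ofReal_mul]
  have hRt : (matFun (fun x => x ^ (1 - s)) (pinch S R) * matFun (fun x => x ^ s) S).trace.re =
      ∑ i, p i ^ (1 - s) * q i ^ s := by
    rw [hp]
    conv_lhs => enter [1, 1, 2]; rw [hq]
    rw [itb_matFun_eq _ U h1 h2, itb_matFun_eq _ U h1 h2, itb_diag_mul U h1,
      Matrix.diagonal_mul_diagonal, ← itb_diag_trace U h1]
    simp only [Complex.ofReal_mul]
  rw [hL, hRt, Finset.mul_sum]
  apply Finset.sum_le_sum
  intro i _
  have hnn : 0 ≤ c ^ s * (p i ^ (1 - s) * q i ^ s) := by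
    have := hp0 i
    have := hq0 i
    positivity
  split_ifs with h
  · simpa using hnn
  · rw [mul_one]
    rcases (hp0 i).eq_or_lt with h0 | h0
    · rw [← h0] at hnn ⊢; exact hnn
    · have hle : p i ≤ c * q i := by linarith
      calc p i = p i ^ (1 - s) * p i ^ s := by
            rw [← Real.rpow_add h0]; simp
        _ ≤ p i ^ (1 - s) * (c * q i) ^ s := by
            gcongr
        _ = _ := by rw [Real.mul_rpow hc.le (hq0 i)]; ring

/-- **Intermediate trace bound.** For the test
`S̄_n(a) = {E_{σ_n}(ρ_n) − e^{na} σ_n > 0}` and `0 ≤ s ≤ 1`,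
`Tr[ρ_n (I − S̄_n(a))] ≤ e^{nas} Tr[E_{σ_n}(ρ_n)^{1−s} σ_n^{s}]`. -/
theorem intermediate_trace_bound {d : ℕ} (hd : 0 < d) (ρ σ : Matrix (Fin d) (Fin d) ℂ)
    (hρ : IsDensity ρ) (hσ : IsDensity σ) (hρpd : ρ.PosDef) (hσpd : σ.PosDef)
    (a : ℝ) (n : ℕ) (hn : 1 ≤ n) (s : ℝ) (hs0 : 0 ≤ s) (hs1 : s ≤ 1) :
    alphaErr ρ n (posProj (pinch (tensorPow σ n) (tensorPow ρ n)
        - (Real.exp (n * a) : ℂ) • tensorPow σ n))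
      ≤ Real.exp ((n : ℝ) * (a * s)) *
        ((matRPow (pinch (tensorPow σ n) (tensorPow ρ n)) (1 - s) *
          matRPow (tensorPow σ n) s).trace).re := by
  have h := itb_general (tensorPow ρ n) (tensorPow σ n)
    (itb_tensorPow_posSemidef ρ hρ.1 n) (itb_tensorPow_posSemidef σ hσ.1 n)
    (Real.exp (n * a)) s (Real.exp_pos _) hs0 hs1
  rw [← Real.exp_mul, mul_assoc] at h
  exact h

end
end
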